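/- Let N ≥ 4 be even, let n = N−1, and let λ ∈ {−1,1}^N satisfy λ_1 + ⋯ + λ_N = 0. Then there exists a nonzero polynomial p in the variables (c_1,…,c_n, a, entries of an n×n matrix R) such that for every c ∈ ℂ^n, a ∈ ℂ∖{0}, and invertible complex n×n matrix R with p(c, a, R) ≠ 0: the set of solutions x ∈ (ℂ∖{0})^n of the facet subsystem determined by (c, a, R, V(λ)) is finite (possibly empty), and at every solution the n×n Jacobian matrix of partial derivatives of the n equations with respect to x_1,…,x_n is invertible. -/

import Mathlib

noncomputable section

/-- The monomial `x^v = ∏_j x_j^{v_j}` (integer exponents). -/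
def mpow {n : ℕ} (x : Fin n → ℂ) (v : Fin n → ℤ) : ℂ := ∏ j, x j ^ v j

/-- The facet matrix `V(λ)`: its `k`-th column (`k = 1, …, N`) is `λ_k (e_{k-1} − e_k)`,
with `e_0 = e_N = 0`. -/
def facetV (N : ℕ) (lam : Fin N → ℤ) : Matrix (Fin (N - 1)) (Fin N) ℤ :=
  Matrix.of fun r k =>
    lam k * ((if (r : ℕ) + 1 = (k : ℕ) then 1 else 0) - (if (r : ℕ) = (k : ℕ) then 1 else 0))

/-- The `i`-th equation `g_i(x) = c_i − a·∑_{k=1}^N (RV)_{ik}·x^{v_k}` of the facet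
subsystem determined by `(c, a, R, V(λ))`, as a function on `(ℂ∖{0})^{N-1}`. -/
def facetG (N : ℕ) (c : Fin (N - 1) → ℂ) (a : ℂ)
    (R : Matrix (Fin (N - 1)) (Fin (N - 1)) ℂ) (lam : Fin N → ℤ)
    (i : Fin (N - 1)) (x : Fin (N - 1) → ℂ) : ℂ :=
  c i - a * ∑ k, (∑ r, R i r * (facetV N lam r k : ℂ)) * mpow x (fun r => facetV N lam r k)

/-- The Jacobian matrix `(∂g_i/∂x_j)` of the facet subsystem at `x`. -/
def facetJac (N : ℕ) (c : Fin (N - 1) → ℂ) (a : ℂ)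
    (R : Matrix (Fin (N - 1)) (Fin (N - 1)) ℂ) (lam : Fin N → ℤ)
    (x : Fin (N - 1) → ℂ) : Matrix (Fin (N - 1)) (Fin (N - 1)) ℂ :=
  Matrix.of fun i j => deriv (fun t => facetG N c a R lam i (Function.update x j t)) (x j)

open Polynomial in
theorem exists_discriminant {σ : Type*} (F : (MvPolynomial σ ℂ)[X]) (z₀ : σ → ℂ)
    (hsep : (F.map (MvPolynomial.eval z₀)).Separable)
    (hdeg : F.natDegree ≤ (F.map (MvPolynomial.eval z₀)).natDegree)
    (hpos : F.natDegree ≠ 0) :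
    ∃ p : MvPolynomial σ ℂ, p ≠ 0 ∧ ∀ z : σ → ℂ, MvPolynomial.eval z p ≠ 0 →
      F.map (MvPolynomial.eval z) ≠ 0 ∧
      ∀ t, (F.map (MvPolynomial.eval z)).eval t = 0 →
        (derivative (F.map (MvPolynomial.eval z))).eval t ≠ 0 := by
  have hd : (F.map (MvPolynomial.eval z₀)).natDegree = F.natDegree :=
    le_antisymm natDegree_map_le hdeg
  have key : ∀ z : σ → ℂ, ∀ t, MvPolynomial.eval z
      (resultant F (derivative F) F.natDegree (F.natDegree - 1)) ≠ 0 →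
      (F.map (MvPolynomial.eval z)).eval t = 0 →
        (derivative (F.map (MvPolynomial.eval z))).eval t ≠ 0 := by
    intro z t hz ht ht'
    obtain ⟨u, v, -, -, huv⟩ := exists_mul_add_mul_eq_C_resultant F (derivative F) le_rfl
      (natDegree_derivative_le F) (Or.inl hpos)
    have := congrArg (fun G => (G.map (MvPolynomial.eval z)).eval t) huv
    simp only [Polynomial.map_add, Polynomial.map_mul, eval_add, eval_mul, map_C, eval_C,
      ← derivative_map, ht, ht', zero_mul, add_zero] at this
    exact hz this.symm
  refine ⟨resultant F (derivative F) F.natDegree (F.natDegree - 1), ?_, fun z hz => ⟨?_, ?_⟩⟩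
  · intro h
    have h1 := resultant_map_map F (derivative F) F.natDegree (F.natDegree - 1)
      (MvPolynomial.eval z₀)
    rw [h, map_zero, ← derivative_map, ← hd] at h1
    have h2 := natDegree_derivative (F.map (MvPolynomial.eval z₀))
    rw [← h2] at h1
    exact resultant_ne_zero _ _ hsep h1
  · intro h
    exact key z 0 hz (by simp [h]) (by simp [h])
  · exact fun t => key z t hz

open Polynomial in
theorem exists_prod_X_add_C_eq {ι : Type*} [DecidableEq ι] (T : Finset ι) (Q : ℂ[X])
    (hQ : Q.Monic) (hdeg : Q.natDegree = T.card) :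
    ∃ b : ι → ℂ, ∏ k ∈ T, (X + C (b k)) = Q := by
  induction T using Finset.induction_on generalizing Q with
  | empty =>
    exact ⟨0, by simpa using (eq_one_of_monic_natDegree_zero hQ (by simpa using hdeg)).symm⟩
  | insert k T hk ih =>
    rw [Finset.card_insert_of_notMem hk] at hdeg
    obtain ⟨r, hr⟩ := IsAlgClosed.exists_root Q (by
      rw [degree_eq_natDegree hQ.ne_zero, hdeg]; exact_mod_cast T.card.succ_ne_zero)
    obtain ⟨Q', rfl⟩ := dvd_iff_isRoot.mpr hr
    have hQ' : Q'.Monic := (monic_X_sub_C r).of_mul_monic_left hQ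
    rw [(monic_X_sub_C r).natDegree_mul hQ', natDegree_X_sub_C] at hdeg
    obtain ⟨b, hb⟩ := ih Q' hQ' (by omega)
    refine ⟨Function.update b k (-r), ?_⟩
    rw [Finset.prod_insert hk, Function.update_self, ← hb]
    congr 1
    · simp [sub_eq_add_neg]
    · refine Finset.prod_congr rfl fun j hj => ?_
      rw [Function.update_of_ne (by rintro rfl; exact hk hj)]

open Polynomial in
theorem exists_separable_X_pow_sub (m : ℕ) (hm : 2 ≤ m) :
    ∃ Q : ℂ[X], Q.Monic ∧ Q.natDegree = m ∧ (X ^ m - C ((-1) ^ m) * Q).Separable ∧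
      (X ^ m - C ((-1) ^ m) * Q).natDegree = if Even m then m - 1 else m := by
  have hs : ∀ d : ℕ, d ≠ 0 → (X ^ d - C (-1) : ℂ[X]).Separable := fun d hd =>
    separable_X_pow_sub_C (-1 : ℂ) (by exact_mod_cast hd) (by simp)
  split_ifs with h
  · have hl : (X ^ (m - 1) + 1 : ℂ[X]).natDegree < m := by
      have := natDegree_X_pow_add_C (n := m - 1) (r := (1 : ℂ))
      rw [map_one] at this
      omega
    have hl' : (X ^ (m - 1) + 1 : ℂ[X]).degree < m := by
      refine degree_le_natDegree.trans_lt (by exact_mod_cast hl)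
    have e : (X ^ m - C ((-1) ^ m) * (X ^ m + (X ^ (m - 1) + 1)) : ℂ[X])
        = - (X ^ (m - 1) - C (-1)) := by
      simp [h.neg_one_pow]
    refine ⟨X ^ m + (X ^ (m - 1) + 1), monic_X_pow_add hl', ?_, ?_, ?_⟩
    · rw [natDegree_add_eq_left_of_natDegree_lt] <;> simp [hl]
    · rw [e]
      exact (hs (m - 1) (by omega)).of_dvd (neg_dvd.mpr dvd_rfl)
    · rw [e, natDegree_neg, natDegree_X_pow_sub_C]
  · have e : (X ^ m - C ((-1) ^ m) * (X ^ m + C 2) : ℂ[X]) = C 2 * (X ^ m - C (-1)) := by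
      simp only [(Nat.not_even_iff_odd.mp h).neg_one_pow, map_neg, map_one, C_ofNat]
      ring
    have h2 : IsUnit (C (2 : ℂ)) := isUnit_C.mpr (by norm_num)
    refine ⟨X ^ m + C 2, monic_X_pow_add_C _ (by omega), natDegree_X_pow_add_C, ?_, ?_⟩
    · rw [e]
      exact (hs m (by omega)).of_dvd (h2.mul_left_dvd.mpr dvd_rfl)
    · rw [e, natDegree_C_mul (by norm_num), natDegree_X_pow_sub_C]

/-- The difference of the two partial products of the `X + B k`, with relative sign `(-1)^m`. -/
def splitPoly {ι A : Type*} [Fintype ι] [DecidableEq ι] [CommRing A] (S : Finset ι) (m : ℕ)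
    (B : ι → A) : Polynomial A :=
  ∏ k ∈ S, (Polynomial.X + Polynomial.C (B k)) -
    Polynomial.C ((-1) ^ m) * ∏ k ∈ Sᶜ, (Polynomial.X + Polynomial.C (B k))

open Polynomial in
theorem splitPoly_map {ι A A' : Type*} [Fintype ι] [DecidableEq ι] [CommRing A] [CommRing A']
    (S : Finset ι) (m : ℕ) (B : ι → A) (φ : A →+* A') :
    (splitPoly S m B).map φ = splitPoly S m (fun k => φ (B k)) := by
  simp [splitPoly, Polynomial.map_prod]

open Polynomial in
theorem splitPoly_natDegree_le {ι A : Type*} [Fintype ι] [DecidableEq ι] [CommRing A]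
    [Nontrivial A] (S : Finset ι) (m : ℕ) (hm : 1 ≤ m) (hS : S.card = m) (hS' : Sᶜ.card = m)
    (B : ι → A) : (splitPoly S m B).natDegree ≤ if Even m then m - 1 else m := by
  have hmon : ∀ T : Finset ι, (∏ k ∈ T, (X + C (B k))).Monic := fun T =>
    monic_prod_of_monic _ _ fun k _ => monic_X_add_C _
  have hnat : ∀ T : Finset ι, (∏ k ∈ T, (X + C (B k))).natDegree = T.card := fun T => by
    rw [natDegree_prod_of_monic _ _ fun k _ => monic_X_add_C _]
    simp
  unfold splitPoly
  split_ifs with h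
  · rw [h.neg_one_pow, map_one, one_mul]
    have := IsMonicOfDegree.natDegree_sub_lt (by omega : m ≠ 0)
      (p := ∏ k ∈ S, (X + C (B k))) (q := ∏ k ∈ Sᶜ, (X + C (B k)))
      ⟨by rw [hnat, hS], hmon _⟩ ⟨by rw [hnat, hS'], hmon _⟩
    omega
  · refine (natDegree_sub_le _ _).trans (max_le (by rw [hnat, hS]) ?_)
    refine (natDegree_C_mul_le _ _).trans (by rw [hnat, hS'])

open Polynomial in
theorem derivative_splitPoly_eval {ι : Type*} [Fintype ι] [DecidableEq ι] (S : Finset ι) (m : ℕ)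
    (B : ι → ℂ) (t : ℂ) (hne : ∀ k, t + B k ≠ 0) (h : (splitPoly S m B).eval t = 0) :
    (derivative (splitPoly S m B)).eval t =
      (∏ k ∈ S, (t + B k)) * (∑ k ∈ S, (t + B k)⁻¹ - ∑ k ∈ Sᶜ, (t + B k)⁻¹) := by
  have hder : ∀ T : Finset ι, (derivative (∏ k ∈ T, (X + C (B k)))).eval t =
      (∏ k ∈ T, (t + B k)) * ∑ k ∈ T, (t + B k)⁻¹ := by
    intro T
    rw [derivative_prod_finset, eval_finsetSum, Finset.mul_sum]
    refine Finset.sum_congr rfl fun k hk => ?_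
    rw [← Finset.mul_prod_erase T _ hk]
    simp only [derivative_add, derivative_X, derivative_C, add_zero, mul_one, eval_prod, eval_add,
      eval_X, eval_C]
    field_simp [hne k]
  have h0 : ∏ k ∈ S, (t + B k) = (-1) ^ m * ∏ k ∈ Sᶜ, (t + B k) := by
    simpa [splitPoly, eval_prod, sub_eq_zero] using h
  rw [splitPoly, derivative_sub, derivative_C_mul, eval_sub, eval_C_mul, hder, hder, mul_sub,
    ← mul_assoc, ← h0]

theorem Fin.map_partialSum {n : ℕ} {A A' : Type*} [Semiring A] [Semiring A'] (φ : A →+* A')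
    (f : Fin n → A) (k : Fin (n + 1)) :
    φ (Fin.partialSum f k) = Fin.partialSum (fun r => φ (f r)) k := by
  induction k using Fin.induction with
  | zero => simp
  | succ r ih => simp [Fin.partialSum_succ, ih]

theorem Fin.partialSum_sub {n : ℕ} {A : Type*} [AddCommGroup A] (y : Fin (n + 1) → A)
    (k : Fin (n + 1)) :
    Fin.partialSum (fun r => y r.succ - y r.castSucc) k = y k - y 0 := by
  induction k using Fin.induction with
  | zero => simp
  | succ r ih => rw [Fin.partialSum_succ, ih]; abel

/-- The consecutive ratios of `1, x_1, …, x_n, 1`. -/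
def ratio {n : ℕ} (x : Fin n → ℂ) (k : Fin (n + 1)) : ℂ :=
  (Fin.cons 1 x : Fin (n + 1) → ℂ) k / (Fin.snoc x 1 : Fin (n + 1) → ℂ) k

theorem cons_one_ne_zero {n : ℕ} {x : Fin n → ℂ} (hx : ∀ j, x j ≠ 0) (k : Fin (n + 1)) :
    (Fin.cons 1 x : Fin (n + 1) → ℂ) k ≠ 0 := by
  cases k using Fin.cases <;> simp [hx]

theorem snoc_one_ne_zero {n : ℕ} {x : Fin n → ℂ} (hx : ∀ j, x j ≠ 0) (k : Fin (n + 1)) :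
    (Fin.snoc x 1 : Fin (n + 1) → ℂ) k ≠ 0 := by
  cases k using Fin.lastCases <;> simp [hx]

theorem ratio_ne_zero {n : ℕ} {x : Fin n → ℂ} (hx : ∀ j, x j ≠ 0) (k : Fin (n + 1)) :
    ratio x k ≠ 0 :=
  div_ne_zero (cons_one_ne_zero hx k) (snoc_one_ne_zero hx k)

theorem prod_ratio {n : ℕ} {x : Fin n → ℂ} (hx : ∀ j, x j ≠ 0) : ∏ k, ratio x k = 1 := by
  unfold ratio
  rw [Finset.prod_div_distrib, Fin.prod_cons, Fin.prod_snoc, one_mul, mul_one]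
  exact div_self (Finset.prod_ne_zero_iff.mpr fun j _ => hx j)

theorem ratio_injective {n : ℕ} {x x' : Fin n → ℂ} (hx : ∀ j, x j ≠ 0)
    (h : ∀ k, ratio x k = ratio x' k) : x = x' := by
  have key : ∀ k : Fin (n + 1),
      (Fin.cons 1 x : Fin (n + 1) → ℂ) k = (Fin.cons 1 x' : Fin (n + 1) → ℂ) k := by
    intro k
    induction k using Fin.induction with
    | zero => simp
    | succ r ih =>
      have h1 := h r.castSucc
      have h2 := cons_one_ne_zero hx r.castSucc
      simp only [ratio, Fin.snoc_castSucc, ← ih] at h1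
      simpa [div_eq_mul_inv, h2] using h1
  funext j
  simpa using key j.succ

theorem mpow_facetV {n : ℕ} {lam : Fin (n + 1) → ℤ} {x : Fin n → ℂ} (hx : ∀ j, x j ≠ 0)
    (k : Fin (n + 1)) :
    mpow x (fun r => facetV (n + 1) lam r k) = ratio x k ^ lam k := by
  have h1 : (Fin.cons 1 x : Fin (n + 1) → ℂ) k =
      ∏ r : Fin n, x r ^ (if (r : ℕ) + 1 = (k : ℕ) then 1 else 0 : ℤ) := by
    cases k using Fin.cases with
    | zero => simp
    | succ j =>
      rw [Fin.cons_succ, Finset.prod_eq_single j] <;> simp +contextual [← Fin.ext_iff]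
  have h2 : (Fin.snoc x 1 : Fin (n + 1) → ℂ) k =
      ∏ r : Fin n, x r ^ (if (r : ℕ) = (k : ℕ) then 1 else 0 : ℤ) := by
    cases k using Fin.lastCases with
    | last =>
      rw [Fin.snoc_last, Finset.prod_eq_one]
      intro r _
      simp [r.isLt.ne]
    | cast j =>
      rw [Fin.snoc_castSucc, Finset.prod_eq_single j] <;> simp +contextual [← Fin.ext_iff]
  rw [ratio, h1, h2, ← Finset.prod_div_distrib, ← Finset.prod_zpow]
  refine Finset.prod_congr rfl fun r _ => ?_
  rw [← zpow_sub₀ (hx r), ← zpow_mul, mul_comm]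
  rfl

theorem sum_facetV_mul {n : ℕ} (lam : Fin (n + 1) → ℤ) (f : Fin (n + 1) → ℂ) (r : Fin n) :
    ∑ k, (facetV (n + 1) lam r k : ℂ) * f k =
      lam r.succ * f r.succ - lam r.castSucc * f r.castSucc := by
  have : ∀ k, (facetV (n + 1) lam r k : ℂ) * f k =
      (if r.succ = k then lam k * f k else 0) - (if r.castSucc = k then lam k * f k else 0) := by
    intro k
    simp only [facetV, Matrix.of_apply, Fin.ext_iff, Fin.val_succ, Fin.val_castSucc]
    split_ifs <;> simp
  simp [this]

theorem sum_mul_facetV {n : ℕ} (lam : Fin (n + 1) → ℤ) (w : Fin n → ℂ) (k : Fin (n + 1)) :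
    ∑ r : Fin n, w r * (facetV (n + 1) lam r k : ℂ) =
      lam k * ((Fin.cons 0 w : Fin (n + 1) → ℂ) k - (Fin.snoc w 0 : Fin (n + 1) → ℂ) k) := by
  have h1 : (Fin.cons 0 w : Fin (n + 1) → ℂ) k =
      ∑ r : Fin n, w r * (if (r : ℕ) + 1 = (k : ℕ) then 1 else 0) := by
    cases k using Fin.cases with
    | zero => simp
    | succ j => simp [← Fin.ext_iff]
  have h2 : (Fin.snoc w 0 : Fin (n + 1) → ℂ) k =
      ∑ r : Fin n, w r * (if (r : ℕ) = (k : ℕ) then 1 else 0) := by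
    cases k using Fin.lastCases with
    | last =>
      rw [Fin.snoc_last, Finset.sum_eq_zero]
      intro r _
      simp [r.isLt.ne]
    | cast j => simp [← Fin.ext_iff]
  rw [h1, h2, ← Finset.sum_sub_distrib, Finset.mul_sum]
  refine Finset.sum_congr rfl fun r _ => ?_
  simp only [facetV, Matrix.of_apply]
  push_cast
  ring

theorem hasDerivAt_mpow_update {n : ℕ} {x : Fin n → ℂ} (hx : ∀ j, x j ≠ 0) (v : Fin n → ℤ)
    (j : Fin n) :
    HasDerivAt (fun t => mpow (Function.update x j t) v) (v j / x j * mpow x v) (x j) := by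
  have e : ∀ t, mpow (Function.update x j t) v =
      t ^ v j * ∏ i ∈ Finset.univ.erase j, x i ^ v i := by
    intro t
    rw [mpow, ← Finset.mul_prod_erase _ _ (Finset.mem_univ j), Function.update_self]
    congr 1
    refine Finset.prod_congr rfl fun i hi => ?_
    rw [Function.update_of_ne (Finset.ne_of_mem_erase hi)]
  have h := (hasDerivAt_zpow (v j) (x j) (Or.inl (hx j))).mul_const
    (∏ i ∈ Finset.univ.erase j, x i ^ v i)
  rw [funext e]
  refine h.congr_deriv ?_
  have e' := e (x j)
  rw [Function.update_eq_self] at e'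
  rw [e', zpow_sub_one₀ (hx j)]
  ring

theorem facetJac_apply {n : ℕ} (c : Fin n → ℂ) (a : ℂ) (R : Matrix (Fin n) (Fin n) ℂ)
    (lam : Fin (n + 1) → ℤ) {x : Fin n → ℂ} (hx : ∀ j, x j ≠ 0) (i j : Fin n) :
    facetJac (n + 1) c a R lam x i j =
      -(a * ∑ k, (∑ r : Fin n, R i r * (facetV (n + 1) lam r k : ℂ)) *
        ((facetV (n + 1) lam j k : ℂ) / x j * ratio x k ^ lam k)) := by
  refine HasDerivAt.deriv ?_
  refine HasDerivAt.const_sub (c i) (HasDerivAt.const_mul a (HasDerivAt.fun_sum fun k _ =>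
    HasDerivAt.const_mul _ ?_))
  rw [← mpow_facetV hx]
  exact hasDerivAt_mpow_update hx _ j

/-- The signed monomials `λ_k x^{v_k}`. -/
def signedMonomial {n : ℕ} (lam : Fin (n + 1) → ℤ) (x : Fin n → ℂ) (k : Fin (n + 1)) : ℂ :=
  lam k * ratio x k ^ lam k

theorem signedMonomial_ne_zero {n : ℕ} {lam : Fin (n + 1) → ℤ}
    (hlam : ∀ k, lam k = 1 ∨ lam k = -1) {x : Fin n → ℂ} (hx : ∀ j, x j ≠ 0) (k : Fin (n + 1)) :
    signedMonomial lam x k ≠ 0 := by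
  rcases hlam k with h | h <;> simpa [signedMonomial, h] using ratio_ne_zero hx k

theorem ratio_eq_of_signedMonomial_eq {n : ℕ} {lam : Fin (n + 1) → ℤ}
    (hlam : ∀ k, lam k = 1 ∨ lam k = -1) {x x' : Fin n → ℂ} {k : Fin (n + 1)}
    (h : signedMonomial lam x k = signedMonomial lam x' k) : ratio x k = ratio x' k := by
  rcases hlam k with hk | hk <;> simpa [signedMonomial, hk] using h

theorem prod_signedMonomial {n m : ℕ} {lam : Fin (n + 1) → ℤ}
    (hlam : ∀ k, lam k = 1 ∨ lam k = -1)
    (hS : (Finset.univ.filter fun k => lam k = lam 0).card = m)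
    (hS' : (Finset.univ.filter fun k => lam k = lam 0)ᶜ.card = m)
    {x : Fin n → ℂ} (hx : ∀ j, x j ≠ 0) :
    ∏ k ∈ Finset.univ.filter (fun k => lam k = lam 0), signedMonomial lam x k =
      (-1) ^ m * ∏ k ∈ (Finset.univ.filter fun k => lam k = lam 0)ᶜ, signedMonomial lam x k := by
  set S := Finset.univ.filter fun k => lam k = lam 0 with hSdef
  have hu : (∏ k ∈ S, ratio x k) * ∏ k ∈ Sᶜ, ratio x k = 1 := by
    rw [Finset.prod_mul_prod_compl, prod_ratio hx]
  have hmem : ∀ k, k ∈ S ↔ lam k = lam 0 := by simp [hSdef]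
  have pos : ∀ T : Finset (Fin (n + 1)), (∀ k ∈ T, lam k = 1) →
      ∏ k ∈ T, signedMonomial lam x k = ∏ k ∈ T, ratio x k := fun T hT =>
    Finset.prod_congr rfl fun k hk => by simp [signedMonomial, hT k hk]
  have neg : ∀ T : Finset (Fin (n + 1)), (∀ k ∈ T, lam k = -1) → T.card = m →
      ∏ k ∈ T, signedMonomial lam x k = (-1) ^ m * (∏ k ∈ T, ratio x k)⁻¹ := fun T hT hc => by
    rw [← hc, ← Finset.prod_const, ← Finset.prod_inv_distrib, ← Finset.prod_mul_distrib]
    exact Finset.prod_congr rfl fun k hk => by simp [signedMonomial, hT k hk]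
  rcases hlam 0 with h0 | h0
  · rw [pos S fun k hk => by rw [(hmem k).mp hk, h0],
      neg Sᶜ (fun k hk => (hlam k).resolve_left (by
        rw [← h0, ← hmem]; exact Finset.mem_compl.mp hk)) hS', ← mul_assoc, ← mul_pow]
    simpa using eq_inv_of_mul_eq_one_left hu
  · rw [neg S (fun k hk => by rw [(hmem k).mp hk, h0]) hS,
      pos Sᶜ fun k hk => (hlam k).resolve_right (by
        rw [← h0, ← hmem]; exact Finset.mem_compl.mp hk)]
    rw [← eq_inv_of_mul_eq_one_right hu]

open Matrix in
theorem facetG_eq {n : ℕ} (c : Fin n → ℂ) (a : ℂ) (R : Matrix (Fin n) (Fin n) ℂ)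
    (lam : Fin (n + 1) → ℤ) {x : Fin n → ℂ} (hx : ∀ j, x j ≠ 0) (i : Fin n) :
    facetG (n + 1) c a R lam i x = c i - a * (R *ᵥ fun r =>
      signedMonomial lam x r.succ - signedMonomial lam x r.castSucc) i := by
  have : ∀ r : Fin n, signedMonomial lam x r.succ - signedMonomial lam x r.castSucc =
      ∑ k, (facetV (n + 1) lam r k : ℂ) * ratio x k ^ lam k := fun r =>
    (sum_facetV_mul lam (fun k => ratio x k ^ lam k) r).symm
  simp only [this, mulVec, dotProduct, Finset.mul_sum]
  have hG : facetG (n + 1) c a R lam i x = c i - a * ∑ k, (∑ r : Fin n,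
      R i r * (facetV (n + 1) lam r k : ℂ)) * mpow x (fun r : Fin n => facetV (n + 1) lam r k) :=
    rfl
  rw [Finset.sum_comm, hG, Finset.mul_sum]
  congr 1
  refine Finset.sum_congr rfl fun k _ => ?_
  rw [mpow_facetV hx, Finset.sum_mul, Finset.mul_sum]
  exact Finset.sum_congr rfl fun r _ => by ring

open Matrix in
theorem adjugate_mulVec_eq_of_facetG_eq_zero {n : ℕ} {c : Fin n → ℂ} {a : ℂ}
    {R : Matrix (Fin n) (Fin n) ℂ} {lam : Fin (n + 1) → ℤ} {x : Fin n → ℂ} (hx : ∀ j, x j ≠ 0)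
    (h : ∀ i : Fin n, facetG (n + 1) c a R lam i x = 0) :
    R.adjugate *ᵥ c = fun r => a * R.det * signedMonomial lam x r.succ -
      a * R.det * signedMonomial lam x r.castSucc := by
  have hc : c = a • (R *ᵥ fun r =>
      signedMonomial lam x r.succ - signedMonomial lam x r.castSucc) := by
    funext i
    have := h i
    rw [facetG_eq c a R lam hx i, sub_eq_zero] at this
    simpa using this
  rw [hc, mulVec_smul, mulVec_mulVec, adjugate_mul, smul_mulVec, one_mulVec]
  funext r
  simp only [Pi.smul_apply, smul_eq_mul]
  ring

open Matrix in
theorem facetJac_isUnit {n : ℕ} (c : Fin n → ℂ) {a : ℂ} (ha : a ≠ 0)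
    {R : Matrix (Fin n) (Fin n) ℂ} (hR : IsUnit R) {lam : Fin (n + 1) → ℤ}
    (hlam : ∀ k, lam k = 1 ∨ lam k = -1) {x : Fin n → ℂ} (hx : ∀ j, x j ≠ 0)
    (hsum : ∑ k, lam k * (signedMonomial lam x k)⁻¹ ≠ 0) :
    IsUnit (facetJac (n + 1) c a R lam x : Matrix (Fin n) (Fin n) ℂ) := by
  have hsq : ∀ k, (lam k : ℂ) * lam k = 1 := fun k => by rcases hlam k with h | h <;> simp [h]
  refine mulVec_injective_iff_isUnit.mp ((injective_iff_map_eq_zero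
    (mulVecLin (facetJac (n + 1) c a R lam x : Matrix (Fin n) (Fin n) ℂ))).mpr fun w hw => ?_)
  rw [mulVecLin_apply] at hw
  set w' : Fin n → ℂ := fun j => w j / x j with hw'
  set z : Fin (n + 1) → ℂ :=
    fun k => (Fin.cons 0 w' : Fin (n + 1) → ℂ) k - (Fin.snoc w' 0 : Fin (n + 1) → ℂ) k with hz
  have hfac : facetJac (n + 1) c a R lam x *ᵥ w = -(a • (R *ᵥ fun r =>
      signedMonomial lam x r.succ * (lam r.succ * z r.succ) -
      signedMonomial lam x r.castSucc * (lam r.castSucc * z r.castSucc))) := by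
    have e : ∀ r : Fin n, signedMonomial lam x r.succ * (lam r.succ * z r.succ) -
      signedMonomial lam x r.castSucc * (lam r.castSucc * z r.castSucc) =
        ∑ k, ∑ j, (facetV (n + 1) lam r k : ℂ) * (ratio x k ^ lam k *
          (w' j * (facetV (n + 1) lam j k : ℂ))) := by
      intro r
      simp only [← Finset.mul_sum]
      rw [Finset.sum_congr rfl fun k _ => by rw [sum_mul_facetV lam w' k], sum_facetV_mul]
      simp only [signedMonomial, hz]
      ring
    funext i
    simp only [mulVec, dotProduct, Pi.neg_apply, Pi.smul_apply, smul_eq_mul, e]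
    simp only [facetJac_apply c a R lam hx, Finset.mul_sum, Finset.sum_mul, neg_mul,
      Finset.sum_neg_distrib]
    congr 1
    refine Finset.sum_comm.trans (Eq.trans (Finset.sum_congr rfl fun k _ => ?_) Finset.sum_comm)
    rw [Finset.sum_comm]
    refine Finset.sum_congr rfl fun r _ => Finset.sum_congr rfl fun j _ => ?_
    simp only [hw']
    ring
  have hdiff : ∀ r : Fin n, signedMonomial lam x r.succ * (lam r.succ * z r.succ) =
      signedMonomial lam x r.castSucc * (lam r.castSucc * z r.castSucc) := by
    have h0 := hfac.symm.trans hw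
    rw [neg_eq_zero, smul_eq_zero_iff_right ha, ← mulVec_zero R] at h0
    intro r
    exact sub_eq_zero.mp (congrFun (mulVec_injective_of_isUnit hR h0) r)
  have hconst : ∀ k, signedMonomial lam x k * (lam k * z k) =
      signedMonomial lam x 0 * (lam 0 * z 0) := by
    intro k
    induction k using Fin.induction with
    | zero => rfl
    | succ r ih => rw [hdiff, ih]
  set δ := signedMonomial lam x 0 * (lam 0 * z 0) with hδ
  have hzk : ∀ k, z k = δ * (lam k * (signedMonomial lam x k)⁻¹) := by
    intro k
    rw [← hconst k]
    have := signedMonomial_ne_zero hlam hx k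
    field_simp
    linear_combination (-z k) * hsq k
  have hzsum : ∑ k, z k = 0 := by
    rw [hz, Finset.sum_sub_distrib, Fin.sum_cons, Fin.sum_snoc, zero_add, add_zero, sub_self]
  have hδ0 : δ = 0 := by
    rw [Finset.sum_congr rfl fun k _ => hzk k, ← Finset.mul_sum] at hzsum
    exact (mul_eq_zero.mp hzsum).resolve_right hsum
  have hz0 : ∀ k, (Fin.cons 0 w' : Fin (n + 1) → ℂ) k = (Fin.snoc w' 0 : Fin (n + 1) → ℂ) k :=
    fun k => sub_eq_zero.mp (by simpa [hδ0] using hzk k)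
  have hcons : ∀ k, (Fin.cons 0 w' : Fin (n + 1) → ℂ) k = 0 := by
    intro k
    induction k using Fin.induction with
    | zero => simp
    | succ r ih => simpa using (hz0 r.castSucc).symm.trans ih
  funext j
  have := hcons j.succ
  simpa [hw', hx j] using this

/-- The parameters `(c, a, R)` of a facet subsystem as a point of affine space. -/
abbrev paramPoint {n : ℕ} (c : Fin n → ℂ) (a : ℂ) (R : Matrix (Fin n) (Fin n) ℂ) :
    Fin n ⊕ Unit ⊕ (Fin n × Fin n) → ℂ :=
  Sum.elim c (Sum.elim (fun _ => a) (fun ij => R ij.1 ij.2))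

/-- The partial sums of the entries of `adj(R) c`, as polynomials in `(c, a, R)`. -/
def genericShift (n : ℕ) (k : Fin (n + 1)) :
    MvPolynomial (Fin n ⊕ Unit ⊕ (Fin n × Fin n)) ℂ :=
  Fin.partialSum ((Matrix.of fun i j => MvPolynomial.X (Sum.inr (Sum.inr (i, j)))).adjugate.mulVec
    fun i => MvPolynomial.X (Sum.inl i)) k

theorem eval_genericShift {n : ℕ} (c : Fin n → ℂ) (a : ℂ) (R : Matrix (Fin n) (Fin n) ℂ)
    (k : Fin (n + 1)) :
    MvPolynomial.eval (paramPoint c a R) (genericShift n k) =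
      Fin.partialSum (R.adjugate.mulVec c) k := by
  rw [genericShift, Fin.map_partialSum]
  congr 1
  funext r
  have hR : (MvPolynomial.eval (paramPoint c a R)).mapMatrix
      (Matrix.of fun i j => MvPolynomial.X (Sum.inr (Sum.inr (i, j)))) = R := by
    ext i j
    simp
  have hc : (MvPolynomial.eval (paramPoint c a R)) ∘ (fun i => MvPolynomial.X (Sum.inl i)) = c := by
    funext i
    simp
  rw [RingHom.map_mulVec, ← RingHom.mapMatrix_apply, RingHom.map_adjugate, hR, hc]

theorem card_filter_eq {n : ℕ} {lam : Fin (n + 1) → ℤ} (hlam : ∀ k, lam k = 1 ∨ lam k = -1)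
    (hsum : ∑ k, lam k = 0) :
    (Finset.univ.filter fun k => lam k = lam 0).card =
      (Finset.univ.filter fun k => lam k = lam 0)ᶜ.card := by
  set S := Finset.univ.filter fun k => lam k = lam 0 with hS
  have h1 : ∀ k ∈ S, lam k = lam 0 := fun k hk => (Finset.mem_filter.mp hk).2
  have h2 : ∀ k ∈ Sᶜ, lam k = -lam 0 := fun k hk => by
    have : lam k ≠ lam 0 := by simpa [hS] using hk
    rcases hlam k with h | h <;> rcases hlam 0 with h' | h' <;> simp_all
  rw [← Finset.sum_add_sum_compl S, Finset.sum_congr rfl h1, Finset.sum_congr rfl h2] at hsum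
  simp only [Finset.sum_const, nsmul_eq_mul] at hsum
  have h0 : lam 0 ≠ 0 := by rcases hlam 0 with h | h <;> simp [h]
  have : ((S.card : ℤ) - Sᶜ.card) * lam 0 = 0 := by linear_combination hsum
  have := (mul_eq_zero.mp this).resolve_right h0
  omega

open Polynomial in
theorem exists_shift_splitPoly_separable {ι : Type*} [Fintype ι] [DecidableEq ι] {S : Finset ι}
    {m : ℕ} (hm : 2 ≤ m) (hS : S.card = m) (hS' : Sᶜ.card = m) :
    ∃ B : ι → ℂ, (∀ k ∈ S, B k = 0) ∧ (splitPoly S m B).Separable ∧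
      (splitPoly S m B).natDegree = if Even m then m - 1 else m := by
  obtain ⟨Q, hQ, hQm, hsep, hdeg⟩ := exists_separable_X_pow_sub m hm
  obtain ⟨b, hb⟩ := exists_prod_X_add_C_eq Sᶜ Q hQ (by rw [hQm, hS'])
  have e : splitPoly S m (fun k => if k ∈ S then 0 else b k) = X ^ m - C ((-1) ^ m) * Q := by
    rw [splitPoly, ← hb]
    congr 1
    · rw [← hS, ← Finset.prod_const]
      exact Finset.prod_congr rfl fun k hk => by simp [hk]
    · congr 1
      exact Finset.prod_congr rfl fun k hk => by simp [Finset.mem_compl.mp hk]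
  exact ⟨fun k => if k ∈ S then 0 else b k, fun k hk => if_pos hk, by rwa [e], by rwa [e]⟩

theorem facet_subsystem_generic {n : ℕ} (hn : 3 ≤ n) (lam : Fin (n + 1) → ℤ)
    (hlam : ∀ k, lam k = 1 ∨ lam k = -1) (hsum : ∑ k, lam k = 0) :
    ∃ p : MvPolynomial (Fin n ⊕ Unit ⊕ (Fin n × Fin n)) ℂ, p ≠ 0 ∧
      ∀ (c : Fin n → ℂ) (a : ℂ) (R : Matrix (Fin n) (Fin n) ℂ), a ≠ 0 → IsUnit R →
        MvPolynomial.eval (paramPoint c a R) p ≠ 0 →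
        {x : Fin n → ℂ | (∀ j, x j ≠ 0) ∧
          ∀ i : Fin n, facetG (n + 1) c a R lam i x = 0}.Finite ∧
        ∀ x : Fin n → ℂ, (∀ j, x j ≠ 0) → (∀ i : Fin n, facetG (n + 1) c a R lam i x = 0) →
          IsUnit (facetJac (n + 1) c a R lam x : Matrix (Fin n) (Fin n) ℂ) := by
  set S := Finset.univ.filter fun k => lam k = lam 0 with hS
  obtain ⟨m, hm⟩ : ∃ m, S.card = m := ⟨_, rfl⟩
  have hm' : Sᶜ.card = m := (card_filter_eq hlam hsum).symm.trans hm
  have hm2 : 2 ≤ m := by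
    have := Finset.card_add_card_compl S
    rw [hm, hm', Fintype.card_fin] at this
    omega
  obtain ⟨B₀, hB₀, hsep, hdeg⟩ := exists_shift_splitPoly_separable hm2 hm hm'
  have hB₀0 : B₀ 0 = 0 := hB₀ 0 (by simp [hS])
  have hmap : (splitPoly S m (genericShift n)).map (MvPolynomial.eval
      (paramPoint (fun r : Fin n => B₀ r.succ - B₀ r.castSucc) 1 1)) = splitPoly S m B₀ := by
    rw [splitPoly_map]
    congr 1
    funext k
    rw [eval_genericShift, Matrix.adjugate_one, Matrix.one_mulVec, Fin.partialSum_sub, hB₀0,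
      sub_zero]
  have hle := splitPoly_natDegree_le S m (by omega) hm hm' (genericShift n)
  rw [← hdeg, ← hmap] at hle
  rw [← hmap] at hsep
  have hpos : (splitPoly S m (genericShift n)).natDegree ≠ 0 := by
    have h := Polynomial.natDegree_map_le (p := splitPoly S m (genericShift n))
      (f := MvPolynomial.eval (paramPoint (fun r : Fin n => B₀ r.succ - B₀ r.castSucc) 1 1))
    rw [hmap, hdeg] at h
    split_ifs at h <;> omega
  obtain ⟨p, hp, hpz⟩ := exists_discriminant _ _ hsep hle hpos
  refine ⟨p, hp, fun c a R ha hR hev => ?_⟩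
  obtain ⟨hF0, hFroot⟩ := hpz _ hev
  have hs : a * R.det ≠ 0 := mul_ne_zero ha ((Matrix.isUnit_iff_isUnit_det R).mp hR).ne_zero
  set s := a * R.det with hsdef
  rw [splitPoly_map] at hF0 hFroot
  simp only [eval_genericShift] at hF0 hFroot
  set B := Fin.partialSum (R.adjugate.mulVec c) with hB
  have hy : ∀ x : Fin n → ℂ, (∀ j, x j ≠ 0) →
      (∀ i : Fin n, facetG (n + 1) c a R lam i x = 0) →
      ∀ k, s * signedMonomial lam x 0 + B k = s * signedMonomial lam x k := by
    intro x hx hg k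
    rw [hB, adjugate_mulVec_eq_of_facetG_eq_zero hx hg,
      Fin.partialSum_sub fun k => a * R.det * signedMonomial lam x k]
    ring
  have hroot : ∀ x : Fin n → ℂ, (∀ j, x j ≠ 0) →
      (∀ i : Fin n, facetG (n + 1) c a R lam i x = 0) →
      (splitPoly S m B).eval (s * signedMonomial lam x 0) = 0 := by
    intro x hx hg
    simp only [splitPoly, Polynomial.eval_sub, Polynomial.eval_mul, Polynomial.eval_C,
      Polynomial.eval_prod, Polynomial.eval_add, Polynomial.eval_X, hy x hx hg,
      Finset.prod_mul_distrib, Finset.prod_const, hm, hm']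
    rw [prod_signedMonomial hlam hm hm' hx]
    ring
  refine ⟨?_, fun x hx hg => ?_⟩
  · refine Set.Finite.of_finite_image ((Polynomial.finite_setOfPred_isRoot hF0).subset
      (Set.image_subset_iff.mpr fun x hx => hroot x hx.1 hx.2))
      (f := fun x => s * signedMonomial lam x 0) fun x hx x' hx' hxx => ?_
    refine ratio_injective hx.1 fun k => ratio_eq_of_signedMonomial_eq hlam ?_
    refine mul_left_cancel₀ hs ?_
    rw [← hy x hx.1 hx.2, ← hy x' hx'.1 hx'.2]
    exact congrArg (· + B k) hxx
  · refine facetJac_isUnit c ha hR hlam hx fun h => hFroot _ (hroot x hx hg) ?_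
    rw [derivative_splitPoly_eval S m B _ (fun k => by
      rw [hy x hx hg]; exact mul_ne_zero hs (signedMonomial_ne_zero hlam hx k)) (hroot x hx hg)]
    have hl : ∀ k ∈ S, (signedMonomial lam x k)⁻¹ =
        lam 0 * (lam k * (signedMonomial lam x k)⁻¹) := fun k hk => by
      have h1 : lam k = lam 0 := (Finset.mem_filter.mp hk).2
      rcases hlam 0 with h | h <;> simp [h1, h]
    have hl' : ∀ k ∈ Sᶜ, (signedMonomial lam x k)⁻¹ =
        -(lam 0 * (lam k * (signedMonomial lam x k)⁻¹)) := fun k hk => by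
      have h1 : lam k ≠ lam 0 := by simpa [hS] using hk
      rcases hlam 0 with h | h <;> rcases hlam k with h' | h' <;> simp_all
    simp only [hy x hx hg, mul_inv, ← Finset.mul_sum]
    rw [Finset.sum_congr rfl hl, Finset.sum_congr rfl hl', Finset.sum_neg_distrib, mul_neg,
      sub_neg_eq_add, ← mul_add, Finset.sum_add_sum_compl, ← Finset.mul_sum, h, mul_zero,
      mul_zero, mul_zero]

/-- for even `N ≥ 4` and a balanced sign vector `λ ∈ {−1,1}^N`, there is a
nonzero polynomial `p` in `(c, a, R)` such that whenever `a ≠ 0`, `R` is invertible, and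
`p(c, a, R) ≠ 0`, the solution set in `(ℂ∖{0})^n` of the facet subsystem determined by
`(c, a, R, V(λ))` is finite, and at every solution the Jacobian matrix is invertible. -/
theorem facet_subsystem_generic_nonsingular (N : ℕ) (hN : 4 ≤ N) (hEven : Even N)
    (lam : Fin N → ℤ) (hlam : ∀ k, lam k = 1 ∨ lam k = -1)
    (hsum : ∑ k, lam k = 0) :
    ∃ p : MvPolynomial (Fin (N - 1) ⊕ Unit ⊕ (Fin (N - 1) × Fin (N - 1))) ℂ, p ≠ 0 ∧
      ∀ (c : Fin (N - 1) → ℂ) (a : ℂ) (R : Matrix (Fin (N - 1)) (Fin (N - 1)) ℂ),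
        a ≠ 0 → IsUnit R →
        MvPolynomial.eval
            (Sum.elim c (Sum.elim (fun _ => a) (fun ij => R ij.1 ij.2))) p ≠ 0 →
        ({x : Fin (N - 1) → ℂ | (∀ j, x j ≠ 0) ∧
            ∀ i, facetG N c a R lam i x = 0} : Set (Fin (N - 1) → ℂ)).Finite ∧
        ∀ x : Fin (N - 1) → ℂ, (∀ j, x j ≠ 0) → (∀ i, facetG N c a R lam i x = 0) →
          IsUnit (facetJac N c a R lam x) := by
  obtain ⟨n, rfl⟩ : ∃ n, N = n + 1 := ⟨N - 1, by omega⟩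
  exact facet_subsystem_generic (by omega) lam hlam hsum
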